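/- arXiv:1202.5715 — 2 statements merged into one kernel-verified Lean document; each statement's English description precedes it below -/
import Mathlib

section
/- Let K, a, b, φ be as in the ear setting. Then for all u, v in the frontier of K with φ(u) < 0 and φ(v) < 0, if u.x < v.x then v.y ≤ u.y. In words: the portion of the boundary of K lying strictly on the southwest side of the chord ab (the obstacle path of the ear) is monotone — the x-coordinate can increase only while the y-coordinate does not increase. (Observation 1 of the paper, pointwise form, for a negative-sloped ear.) -/
open scoped ENNReal

noncomputable section

/-- The plane with the `L1` metric. -/
abbrev Plane : Type := WithLp 1 (ℝ × ℝ)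

/-- The `x`-coordinate of a point of the `L1` plane. -/
def px (p : Plane) : ℝ := (WithLp.equiv 1 (ℝ × ℝ) p).1

/-- The `y`-coordinate of a point of the `L1` plane. -/
def py (p : Plane) : ℝ := (WithLp.equiv 1 (ℝ × ℝ) p).2

lemma continuous_px : Continuous px :=
  continuous_fst.comp (WithLp.prod_continuous_ofLp 1 ℝ ℝ)

lemma continuous_py : Continuous py :=
  continuous_snd.comp (WithLp.prod_continuous_ofLp 1 ℝ ℝ)

lemma plane_ext {p q : Plane} (hx : px p = px q) (hy : py p = py q) : p = q :=
  (WithLp.equiv 1 (ℝ × ℝ)).injective (Prod.ext hx hy)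

lemma px_add (p q : Plane) : px (p + q) = px p + px q := rfl

lemma py_add (p q : Plane) : py (p + q) = py p + py q := rfl

lemma px_smul (c : ℝ) (p : Plane) : px (c • p) = c * px p := rfl

lemma py_smul (c : ℝ) (p : Plane) : py (c • p) = c * py p := rfl

/-- Twice the signed area of the triangle `pqr`, positive when it is counterclockwise. -/
def orient (p q r : Plane) : ℝ :=
  (px q - px p) * (py r - py p) - (py q - py p) * (px r - px p)

/-- A point strictly to the left of all three sides of a counterclockwise triangle with vertices
in a convex set belongs to that set. -/
lemma Convex.mem_of_orient_pos {K : Set Plane} (hK : Convex ℝ K) {p q r z : Plane}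
    (hp : p ∈ K) (hq : q ∈ K) (hr : r ∈ K)
    (h₁ : 0 < orient z q r) (h₂ : 0 < orient p z r) (h₃ : 0 < orient p q z) : z ∈ K := by
  have hsum : orient z q r + orient p z r + orient p q z = orient p q r := by
    unfold orient; ring
  have hD : 0 < orient p q r := by linarith
  have hz : (orient z q r / orient p q r) • p + (orient p z r / orient p q r) • q
      + (orient p q z / orient p q r) • r = z := by
    apply plane_ext
    · simp only [px_add, px_smul]
      field_simp
      unfold orient; ring
    · simp only [py_add, py_smul]
      field_simp
      unfold orient; ring
  have hmem := hK.sum_mem (t := Finset.univ)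
    (w := ![orient z q r / orient p q r, orient p z r / orient p q r,
      orient p q z / orient p q r]) (z := ![p, q, r])
    (by intro i _; fin_cases i <;> simp <;> positivity)
    (by simp only [Fin.sum_univ_three, Matrix.cons_val]; field_simp; exact hsum)
    (by intro i _; fin_cases i <;> simpa)
  simpa only [Fin.sum_univ_three, Matrix.cons_val, hz] using hmem

/-- A point strictly inside a counterclockwise triangle with vertices in a convex set is interior
to that set. -/
lemma Convex.mem_interior_of_orient_pos {K : Set Plane} (hK : Convex ℝ K) {p q r z : Plane}
    (hp : p ∈ K) (hq : q ∈ K) (hr : r ∈ K)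
    (h₁ : 0 < orient z q r) (h₂ : 0 < orient p z r) (h₃ : 0 < orient p q z) :
    z ∈ interior K := by
  have hx := continuous_px
  have hy := continuous_py
  have hc₁ : Continuous fun w => orient w q r := by unfold orient; fun_prop
  have hc₂ : Continuous fun w => orient p w r := by unfold orient; fun_prop
  have hc₃ : Continuous fun w => orient p q w := by unfold orient; fun_prop
  refine mem_interior.2 ⟨{w | 0 < orient w q r ∧ 0 < orient p w r ∧ 0 < orient p q w},
    fun w hw => hK.mem_of_orient_pos hp hq hr hw.1 hw.2.1 hw.2.2, ?_, h₁, h₂, h₃⟩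
  exact (isOpen_lt continuous_const hc₁).inter
    ((isOpen_lt continuous_const hc₂).inter (isOpen_lt continuous_const hc₃))

/-- For a negative-sloped ear of a compact convex set `K` (with `a` a bottommost
point and `b` a leftmost point of `K`), the portion of the boundary of `K` lying
strictly southwest of the chord `ab` is monotone: if the `x`-coordinate increases,
the `y`-coordinate does not increase. -/
theorem obstaclePath_monotone (K : Set Plane) (hKc : IsCompact K) (hKconv : Convex ℝ K)
    (a b : Plane) (ha : a ∈ K) (hb : b ∈ K)
    (hay : ∀ q ∈ K, py a ≤ py q) (hbx : ∀ q ∈ K, px b ≤ px q)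
    (hx : px b < px a) (hy : py a < py b) :
    ∀ u ∈ frontier K, ∀ v ∈ frontier K,
      (py b - py a) * (px u - px a) + (px a - px b) * (py u - py a) < 0 →
      (py b - py a) * (px v - px a) + (px a - px b) * (py v - py a) < 0 →
      px u < px v → py v ≤ py u := by
  intro u hu v hv hφu hφv hxuv
  by_contra! hyuv
  have huK : u ∈ K := hKc.isClosed.frontier_subset hu
  have hbu := hbx u huK
  have hau := hay u huK
  have hub : py u < py b := by nlinarith
  have hua : px u < px a := by nlinarith
  refine hv.2 (hKconv.mem_interior_of_orient_pos huK ha hb ?_ ?_ ?_)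
  · unfold orient
    linarith
  · unfold orient
    nlinarith [mul_pos (sub_pos.2 hxuv) (sub_pos.2 hub),
      mul_nonneg (sub_pos.2 hyuv).le (sub_nonneg.2 hbu)]
  · unfold orient
    nlinarith [mul_pos (sub_pos.2 hua) (sub_pos.2 hyuv),
      mul_nonneg (sub_nonneg.2 hau) (sub_pos.2 hxuv).le]
end
end

section
/- Assume the obstacle setting with obstacles K₁, …, K_h and cores C₁, …, C_h. Let s, t ∈ ℝ² with s, t ∉ interior Kᵢ for all i. Then the infimum, over all continuous paths γ : [0,1] → ℝ² with γ(0) = s, γ(1) = t and image disjoint from ⋃ᵢ interior Cᵢ, of the L1 length of γ, equals the infimum, over all continuous paths γ : [0,1] → ℝ² with γ(0) = s, γ(1) = t and image disjoint from ⋃ᵢ interior Kᵢ, of the L1 length of γ (infima taken in ℝ≥0∞). In words: the L1 geodesic distance among the obstacles equals the L1 geodesic distance among their cores. (Corollary after Lemma 4 of the paper: a shortest s–t path avoiding the obstacles is a shortest s–t path avoiding the cores; this is the mathematical core of Theorem 1.) -/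
open scoped ENNReal

noncomputable section

open Set Filter Topology

section Variation

variable {E : Type*} [PseudoEMetricSpace E]

theorem edist_le_eVariationOn_of_eventually_edist_le {γ δ : ℝ → E} {a b : ℝ} (hab : a ≤ b)
    (h : ∀ s ∈ Icc a b, ∀ᶠ x in 𝓝[Icc a b] s, edist (δ s) (δ x) ≤ edist (γ s) (γ x)) :
    edist (δ a) (δ b) ≤ eVariationOn γ (Icc a b) := by
  have step : ∀ x y, a ≤ x → x ≤ y → edist (δ a) (δ x) ≤ eVariationOn γ (Icc a x) →
      edist (δ x) (δ y) ≤ edist (γ x) (γ y) → edist (δ a) (δ y) ≤ eVariationOn γ (Icc a y) := by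
    intro x y hx hxy h1 h2
    have h3 := eVariationOn.Icc_add_Icc γ (s := univ) hx hxy (mem_univ x)
    simp only [univ_inter] at h3
    rw [← h3]
    exact (edist_triangle _ (δ x) _).trans (add_le_add h1 (h2.trans
      (eVariationOn.edist_le γ (left_mem_Icc.2 hxy) (right_mem_Icc.2 hxy))))
  by_contra hb
  set B : Set ℝ := {c ∈ Icc a b | ¬ edist (δ a) (δ c) ≤ eVariationOn γ (Icc a c)} with hB
  have hBne : B.Nonempty := ⟨b, right_mem_Icc.2 hab, hb⟩
  have hBbdd : BddBelow B := ⟨a, fun c hc => hc.1.1⟩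
  have hgood : ∀ x ∈ Icc a b, x < sInf B → edist (δ a) (δ x) ≤ eVariationOn γ (Icc a x) := by
    intro x hx hlt
    by_contra hbad
    exact absurd (csInf_le hBbdd ⟨hx, hbad⟩) (not_le.2 hlt)
  have hc : sInf B ∈ Icc a b :=
    ⟨le_csInf hBne fun c hc => hc.1.1, csInf_le hBbdd ⟨right_mem_Icc.2 hab, hb⟩⟩
  obtain ⟨ε, hε, hloc⟩ := Metric.eventually_nhds_iff.1 (eventually_nhdsWithin_iff.1 (h _ hc))
  have hcgood : edist (δ a) (δ (sInf B)) ≤ eVariationOn γ (Icc a (sInf B)) := by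
    rcases hc.1.eq_or_lt with h0 | h0
    · rw [← h0]; simp
    · set x := max a (sInf B - ε / 2) with hx
      have hxa : a ≤ x := le_max_left _ _
      have hxc : x < sInf B := max_lt h0 (by linarith)
      have hxε : sInf B - ε / 2 ≤ x := le_max_right _ _
      have hxm : x ∈ Icc a b := ⟨hxa, hxc.le.trans hc.2⟩
      refine step x _ hxa hxc.le (hgood x hxm hxc) ?_
      rw [edist_comm (δ x), edist_comm (γ x)]
      refine hloc ?_ hxm
      rw [Real.dist_eq, abs_lt]
      constructor <;> linarith
  obtain ⟨y, hyB, hy⟩ := exists_lt_of_csInf_lt hBne (show sInf B < sInf B + ε by linarith)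
  have hcy : sInf B ≤ y := csInf_le hBbdd hyB
  refine hyB.2 (step _ y hc.1 hcy hcgood (hloc ?_ hyB.1))
  rw [Real.dist_eq, abs_lt]
  constructor <;> linarith

theorem eVariationOn_Icc_le_of_eventually_edist_le {γ δ : ℝ → E} {a b : ℝ}
    (h : ∀ s ∈ Icc a b, ∀ᶠ x in 𝓝[Icc a b] s, edist (δ s) (δ x) ≤ edist (γ s) (γ x)) :
    eVariationOn δ (Icc a b) ≤ eVariationOn γ (Icc a b) := by
  refine iSup_le fun ⟨n, u, hu, hmem⟩ => ?_
  calc ∑ i ∈ Finset.range n, edist (δ (u (i + 1))) (δ (u i))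
      ≤ ∑ i ∈ Finset.range n, eVariationOn γ (Icc (u i) (u (i + 1))) := by
        refine Finset.sum_le_sum fun i _ => ?_
        rw [edist_comm]
        have hsub : Icc (u i) (u (i + 1)) ⊆ Icc a b := Icc_subset_Icc (hmem i).1 (hmem (i + 1)).2
        exact edist_le_eVariationOn_of_eventually_edist_le (hu (Nat.le_succ i)) fun s hs =>
          nhdsWithin_mono _ hsub (h s (hsub hs))
    _ = eVariationOn γ (Icc (u 0) (u n)) := eVariationOn.sum' γ hu
    _ ≤ eVariationOn γ (Icc a b) := eVariationOn.mono γ (Icc_subset_Icc (hmem 0).1 (hmem n).2)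

theorem continuousOn_of_eventually_edist_le {γ δ : ℝ → E} {S : Set ℝ} (hγ : ContinuousOn γ S)
    (h : ∀ s ∈ S, ∀ᶠ x in 𝓝[S] s, edist (δ s) (δ x) ≤ edist (γ s) (γ x)) : ContinuousOn δ S := by
  intro s hs
  have h1 := EMetric.tendsto_nhds.1 (hγ s hs)
  refine EMetric.tendsto_nhds.2 fun ε hε => ?_
  filter_upwards [h1 ε hε, h s hs] with x hx hx'
  rw [edist_comm] at hx ⊢
  exact hx'.trans_lt hx

end Variation

section Push

variable {E : Type*} [PseudoEMetricSpace E]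

/-- `δ` is a path on `[0, 1]` not longer than `γ`, obtained from `γ` by moving points of the
interior of `K`, the moved points ending up on the boundary of `K`. -/
structure IsPush (K : Set E) (γ δ : ℝ → E) : Prop where
  continuousOn : ContinuousOn δ (Icc 0 1)
  eVariationOn_le : eVariationOn δ (Icc 0 1) ≤ eVariationOn γ (Icc 0 1)
  eq_or_mem : ∀ s ∈ Icc (0 : ℝ) 1, δ s = γ s ∨ δ s ∈ K \ interior K
  eq_of_notMem : ∀ s ∈ Icc (0 : ℝ) 1, γ s ∉ interior K → δ s = γ s

theorem IsPush.trans {K : Set E} {γ δ η : ℝ → E} (h : IsPush K γ δ) (h' : IsPush K δ η) :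
    IsPush K γ η where
  continuousOn := h'.continuousOn
  eVariationOn_le := h'.eVariationOn_le.trans h.eVariationOn_le
  eq_or_mem s hs := by
    rcases h'.eq_or_mem s hs with e | e
    · rw [e]
      exact h.eq_or_mem s hs
    · exact Or.inr e
  eq_of_notMem s hs hn := by
    have e := h.eq_of_notMem s hs hn
    rw [h'.eq_of_notMem s hs (e ▸ hn), e]

theorem IsPush.notMem {K U : Set E} {γ δ : ℝ → E} (h : IsPush K γ δ)
    (hU : Disjoint U (K \ interior K)) (hγ : ∀ s ∈ Icc (0 : ℝ) 1, γ s ∉ U) :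
    ∀ s ∈ Icc (0 : ℝ) 1, δ s ∉ U := by
  intro s hs hmem
  rcases h.eq_or_mem s hs with e | e
  · exact hγ s hs (e ▸ hmem)
  · exact disjoint_left.1 hU hmem e

end Push

section Corner

variable {E : Type*} [NormedAddCommGroup E] [NormedSpace ℝ E]

/-- `X` and `Y` are coordinates of an `L1` plane `E`, the points `R` and `T` of `K` maximize `X` and
`Y` over `K`, and `L` is a further point of `K` in the lower left quadrant at `T`. -/
structure IsL1Corner (X Y : E →L[ℝ] ℝ) (K : Set E) (T R L : E) : Prop where
  dist_eq : ∀ p q, dist p q = |X p - X q| + |Y p - Y q|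
  T_mem : T ∈ K
  R_mem : R ∈ K
  L_mem : L ∈ K
  le_X : ∀ q ∈ K, X q ≤ X R
  le_Y : ∀ q ∈ K, Y q ≤ Y T
  L_le : X L ≤ X T
  T_ne_R : T ≠ R
  L_ne_T : L ≠ T

/-- The affine form vanishing on the line `T R` and increasing in both coordinates. -/
def edgeForm (X Y : E →L[ℝ] ℝ) (T R q : E) : ℝ :=
  (Y T - Y R) * (X q - X T) + (X R - X T) * (Y q - Y T)

@[fun_prop]
theorem continuous_edgeForm (X Y : E →L[ℝ] ℝ) (T R : E) : Continuous (edgeForm X Y T R) := by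
  unfold edgeForm
  fun_prop

namespace IsL1Corner

variable {X Y : E →L[ℝ] ℝ} {K C : Set E} {T R L p q w z : E}

theorem ext (hc : IsL1Corner X Y K T R L) (hX : X p = X q) (hY : Y p = Y q) : p = q := by
  rw [← dist_eq_zero, hc.dist_eq, hX, hY]
  simp

theorem slopes (hc : IsL1Corner X Y K T R L) :
    0 ≤ Y T - Y R ∧ 0 ≤ X R - X T ∧ 0 < (Y T - Y R) + (X R - X T) := by
  have h1 := hc.le_Y R hc.R_mem
  have h2 := hc.le_X T hc.T_mem
  refine ⟨by linarith, by linarith, ?_⟩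
  by_contra h
  exact hc.T_ne_R (hc.ext (by linarith) (by linarith))

theorem slopes_pos (hc : IsL1Corner X Y K T R L) (h0 : edgeForm X Y T R q = 0) (hX : X q < X R)
    (hY : Y q < Y T) : 0 < Y T - Y R ∧ 0 < X R - X T ∧ X T < X q := by
  obtain ⟨h1, h2, h3⟩ := hc.slopes
  unfold edgeForm at h0
  have hA : 0 < Y T - Y R := by
    rcases h1.eq_or_lt with h | h
    · nlinarith
    · exact h
  have hB : 0 < X R - X T := by
    rcases h2.eq_or_lt with h | h
    · rw [← h, zero_mul, add_zero, mul_eq_zero] at h0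
      rcases h0 with h0 | h0 <;> linarith
    · exact h
  refine ⟨hA, hB, ?_⟩
  by_contra hle
  nlinarith

theorem edgeForm_L_neg (hc : IsL1Corner X Y K T R L) (hA : 0 < Y T - Y R) (hB : 0 < X R - X T) :
    edgeForm X Y T R L < 0 := by
  have h1 := hc.L_le
  have h2 := hc.le_Y L hc.L_mem
  unfold edgeForm
  by_contra! h
  exact hc.L_ne_T (hc.ext (by nlinarith) (by nlinarith))

/-- Near a point of the open edge `T R`, the side of the edge containing `w` lies in every convex
set containing `T`, `R` and `w`. -/
theorem eventually_mem_of_same_side (hc : IsL1Corner X Y K T R L) (hC : Convex ℝ C) (hT : T ∈ C)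
    (hR : R ∈ C) (hw : w ∈ C) (hw0 : edgeForm X Y T R w ≠ 0) (h0 : edgeForm X Y T R q = 0)
    (hX : X q < X R) (hY : Y q < Y T) :
    ∀ᶠ z in 𝓝 q, 0 ≤ edgeForm X Y T R z / edgeForm X Y T R w → z ∈ C := by
  obtain ⟨hA, hB, hTq⟩ := hc.slopes_pos h0 hX hY
  set c : E → ℝ := fun z => edgeForm X Y T R z / edgeForm X Y T R w with hcdef
  set β : E → ℝ := fun z => (X z - X T - c z * (X w - X T)) / (X R - X T) with hβ
  have hcc : Continuous c := (continuous_edgeForm X Y T R).div_const _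
  have hβc : Continuous β := by fun_prop
  have hcq : c q = 0 := by simp [hcdef, h0]
  have hβq : β q = (X q - X T) / (X R - X T) := by simp [hβ, hcq]
  have h1 : ∀ᶠ z in 𝓝 q, 0 < β z := by
    refine hβc.continuousAt.eventually_const_lt ?_
    rw [hβq]
    exact div_pos (by linarith) hB
  have h2 : ∀ᶠ z in 𝓝 q, 0 < 1 - c z - β z := by
    refine (show Continuous fun z => 1 - c z - β z by fun_prop).continuousAt.eventually_const_lt ?_
    beta_reduce
    rw [hβq, hcq, sub_zero, sub_pos, div_lt_one hB]
    linarith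
  filter_upwards [h1, h2] with z hz1 hz2 hz3
  have hβz : β z * (X R - X T) = X z - X T - c z * (X w - X T) := div_mul_cancel₀ _ hB.ne'
  have hcz : c z * edgeForm X Y T R w = edgeForm X Y T R z := div_mul_cancel₀ _ hw0
  have hz : z = (1 - c z - β z) • T + β z • R + c z • w := by
    refine hc.ext ?_ ?_
    · simp only [map_add, map_smul, smul_eq_mul]
      linarith
    · simp only [map_add, map_smul, smul_eq_mul]
      unfold edgeForm at hcz
      refine mul_left_cancel₀ hB.ne' ?_
      linear_combination (-(1 : ℝ)) * hcz - (Y R - Y T) * hβz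
  have hmem := hC.sum_mem (t := Finset.univ) (w := ![1 - c z - β z, β z, c z]) (z := ![T, R, w])
    (by intro i _; fin_cases i; exacts [hz2.le, hz1.le, hz3])
    (by simp [Fin.sum_univ_three])
    (by intro i _; fin_cases i <;> simp [hT, hR, hw])
  simp only [Fin.sum_univ_three] at hmem
  rw [hz]
  simpa using hmem

theorem eventually_mem_interior (hc : IsL1Corner X Y K T R L) (hC : Convex ℝ C) (hT : T ∈ C)
    (hR : R ∈ C) (hL : L ∈ C) (h0 : edgeForm X Y T R q = 0) (hX : X q < X R) (hY : Y q < Y T) :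
    ∀ᶠ z in 𝓝 q, edgeForm X Y T R z < 0 → z ∈ interior C := by
  obtain ⟨hA, hB, -⟩ := hc.slopes_pos h0 hX hY
  have hL0 := hc.edgeForm_L_neg hA hB
  filter_upwards [(hc.eventually_mem_of_same_side hC hT hR hL hL0.ne h0 hX hY).eventually_nhds]
    with z hz hneg
  rw [mem_interior_iff_mem_nhds]
  filter_upwards [hz, (continuous_edgeForm X Y T R).continuousAt.eventually_lt_const hneg]
    with z' h1 h2
  exact h1 (div_nonneg_of_nonpos h2.le hL0.le)

/-- A point beyond the edge `T R` that is strictly dominated by a point of `K` is interior. -/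
theorem mem_interior_of_lt (hc : IsL1Corner X Y K T R L) (hK : Convex ℝ K)
    (hp : 0 ≤ edgeForm X Y T R p) (hq : q ∈ K) (hX : X p < X q) (hY : Y p < Y q) :
    p ∈ interior K := by
  obtain ⟨h1, h2, h3⟩ := hc.slopes
  have hlt : 0 < edgeForm X Y T R q - edgeForm X Y T R p := by
    unfold edgeForm
    rcases h1.eq_or_lt with h | h <;> nlinarith
  set μ := edgeForm X Y T R p / (edgeForm X Y T R q - edgeForm X Y T R p) with hμ
  have hμ0 : 0 ≤ μ := div_nonneg hp hlt.le
  have hμe : μ * (edgeForm X Y T R q - edgeForm X Y T R p) = edgeForm X Y T R p :=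
    div_mul_cancel₀ _ hlt.ne'
  set o := p - μ • (q - p) with ho
  have hXo : X o = X p - μ * (X q - X p) := by simp [ho]
  have hYo : Y o = Y p - μ * (Y q - Y p) := by simp [ho]
  have ho0 : edgeForm X Y T R o = 0 := by
    unfold edgeForm at hμe ⊢
    rw [hXo, hYo]
    linear_combination -hμe
  have hoX : X o < X R := by
    have := hc.le_X q hq
    nlinarith [mul_nonneg hμ0 (sub_nonneg.2 hX.le)]
  have hoY : Y o < Y T := by
    have := hc.le_Y q hq
    nlinarith [mul_nonneg hμ0 (sub_nonneg.2 hY.le)]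
  have hq0 : 0 < edgeForm X Y T R q := by linarith
  obtain ⟨hA, hB, -⟩ := hc.slopes_pos ho0 hoX hoY
  have hL0 := hc.edgeForm_L_neg hA hB
  have hoK : o ∈ interior K := by
    rw [mem_interior_iff_mem_nhds]
    filter_upwards [
      hc.eventually_mem_of_same_side hK hc.T_mem hc.R_mem hc.L_mem hL0.ne ho0 hoX hoY,
      hc.eventually_mem_of_same_side hK hc.T_mem hc.R_mem hq hq0.ne' ho0 hoX hoY] with z hz1 hz2
    rcases le_total 0 (edgeForm X Y T R z) with h | h
    · exact hz2 (div_nonneg h hq0.le)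
    · exact hz1 (div_nonneg_of_nonpos h hL0.le)
  have h1μ : 0 < 1 + μ := by linarith
  have hpo : p = q + (1 + μ)⁻¹ • (o - q) := by
    have : o - q = (1 + μ) • (p - q) := by rw [ho]; module
    rw [this, smul_smul, inv_mul_cancel₀ h1μ.ne']
    module
  rw [hpo]
  exact hK.add_smul_sub_mem_interior hq hoK
    ⟨inv_pos.2 h1μ, inv_le_one_of_one_le₀ (by linarith)⟩

theorem exists_push (hc : IsL1Corner X Y K T R L) (hK : IsCompact K) {d : E} (hXd : X d = 1)
    (hp : p ∈ K) : ∃ c : ℝ, 0 ≤ c ∧ p + c • d ∈ K \ interior K := by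
  have hcont : Continuous fun c : ℝ => p + c • d := by fun_prop
  set S : Set ℝ := Icc 0 (X R - X p) ∩ (fun c : ℝ => p + c • d) ⁻¹' K with hS
  have hScomp : IsCompact S := isCompact_Icc.inter_right (hK.isClosed.preimage hcont)
  have hmem : ∀ c : ℝ, 0 ≤ c → p + c • d ∈ K → c ∈ S := by
    intro c hc0 hcK
    have := hc.le_X _ hcK
    simp only [map_add, map_smul, smul_eq_mul, hXd, mul_one] at this
    exact ⟨⟨hc0, by linarith⟩, hcK⟩
  obtain ⟨c, hcS, hcmax⟩ := hScomp.exists_isGreatest ⟨0, hmem 0 le_rfl (by simpa using hp)⟩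
  refine ⟨c, hcS.1.1, hcS.2, fun hint => ?_⟩
  have hev : ∀ᶠ c' in 𝓝 c, p + c' • d ∈ K :=
    hcont.continuousAt.eventually (mem_interior_iff_mem_nhds.1 hint)
  obtain ⟨c', hc', hlt⟩ :=
    ((hev.filter_mono nhdsWithin_le_nhds).and (self_mem_nhdsWithin (s := Ioi c))).exists
  exact absurd (hcmax (hmem c' (hcS.1.1.trans hlt.le) hc')) (not_le.2 hlt)

/-- There is a nonexpansive map that moves the part of `K` beyond the edge `T R` to the boundary
of `K`. -/
theorem exists_push_map (hc : IsL1Corner X Y K T R L) (hK : IsCompact K) (hKc : Convex ℝ K) {d : E}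
    (hXd : X d = 1) (hYd : Y d = 1) :
    ∃ f : E → E, (∀ p ∈ K, f p ∈ K \ interior K) ∧
      (∀ p ∈ K \ interior K, 0 ≤ edgeForm X Y T R p → f p = p) ∧
      ∀ p ∈ K, ∀ q ∈ K, 0 ≤ edgeForm X Y T R p → 0 ≤ edgeForm X Y T R q →
        edist (f p) (f q) ≤ edist p q := by
  choose! c hc0 hcK using fun p (hp : p ∈ K) => hc.exists_push hK hXd hp
  obtain ⟨h1, h2, h3⟩ := hc.slopes
  have hX : ∀ p, X (p + c p • d) = X p + c p := by simp [hXd]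
  have hY : ∀ p, Y (p + c p • d) = Y p + c p := by simp [hYd]
  have hφ : ∀ p ∈ K, 0 ≤ edgeForm X Y T R p → 0 ≤ edgeForm X Y T R (p + c p • d) := by
    intro p hp h
    have := mul_nonneg (hc0 p hp) h3.le
    unfold edgeForm at h ⊢
    rw [hX, hY]
    linarith
  refine ⟨fun p => p + c p • d, hcK, fun p hp h => ?_, fun p hp q hq hp0 hq0 => ?_⟩
  · rcases (hc0 p hp.1).eq_or_lt with h0 | h0
    · simp [← h0]
    · exact absurd (hc.mem_interior_of_lt hKc h (hcK p hp.1).1 (by rw [hX]; linarith)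
        (by rw [hY]; linarith)) hp.2
  · have key : ∀ p ∈ K, ∀ q ∈ K, 0 ≤ edgeForm X Y T R p →
        ¬ (X p + c p < X q + c q ∧ Y p + c p < Y q + c q) := by
      rintro p hp q hq hp0 ⟨hx, hy⟩
      exact (hcK p hp).2 (hc.mem_interior_of_lt hKc (hφ p hp hp0) (hcK q hq).1
        (by rwa [hX, hX]) (by rwa [hY, hY]))
    have k1 := key p hp q hq hp0
    have k2 := key q hq p hp hq0
    rw [edist_dist, edist_dist]
    refine ENNReal.ofReal_le_ofReal ?_
    rw [hc.dist_eq, hc.dist_eq, hX, hX, hY, hY]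
    have t1 := le_abs_self (X p - X q)
    have t2 := neg_le_abs (X p - X q)
    have t3 := le_abs_self (Y p - Y q)
    have t4 := neg_le_abs (Y p - Y q)
    by_cases e1 : X p + c p < X q + c q
    · rw [abs_of_neg (by linarith : X p + c p - (X q + c q) < 0), abs_of_nonneg (by
        by_contra h
        exact k1 ⟨e1, by linarith⟩)]
      linarith
    · rcases (not_lt.1 e1).eq_or_lt with e2 | e2
      · rw [← e2, sub_self, abs_zero, zero_add]
        refine abs_le.2 ⟨by linarith, by linarith⟩
      · rw [abs_of_pos (by linarith : 0 < X p + c p - (X q + c q)), abs_of_nonpos (by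
          by_contra h
          exact k2 ⟨e2, by linarith⟩)]
        linarith

/-- A point on the inner side of the edge `T R` is dominated by a point of the edge. -/
theorem exists_mem_segment_ge (hc : IsL1Corner X Y K T R L) (hp : p ∈ K)
    (hneg : edgeForm X Y T R p < 0) : ∃ w ∈ segment ℝ T R, X p ≤ X w ∧ Y p ≤ Y w := by
  have hX := hc.le_X p hp
  have hY := hc.le_Y p hp
  rcases le_or_gt (X p) (X T) with h | h
  · exact ⟨T, left_mem_segment ℝ T R, h, hY⟩
  have hB : 0 < X R - X T := by linarith
  set θ := (X p - X T) / (X R - X T) with hθ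
  have hθe : θ * (X R - X T) = X p - X T := div_mul_cancel₀ _ hB.ne'
  refine ⟨T + θ • (R - T), ?_, ?_, ?_⟩
  · rw [segment_eq_image']
    exact ⟨θ, ⟨div_nonneg (by linarith) hB.le, (div_le_one hB).2 (by linarith)⟩, rfl⟩
  · simp only [map_add, map_smul, map_sub, smul_eq_mul]
    linarith
  · simp only [map_add, map_smul, map_sub, smul_eq_mul]
    unfold edgeForm at hneg
    by_contra! hlt
    have h1 := mul_lt_mul_of_pos_left hlt hB
    have h2 : θ * (X R - X T) * (Y R - Y T) = (X p - X T) * (Y R - Y T) := by rw [hθe]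
    linarith

end IsL1Corner

theorem IsL1Corner.exists_isPush {X Y : E →L[ℝ] ℝ} {K C : Set E} {T R L : E}
    (hc : IsL1Corner X Y K T R L) (hK : IsCompact K) (hKc : Convex ℝ K) {d : E}
    (hXd : X d = 1) (hYd : Y d = 1) (hC : Convex ℝ C) (hT : T ∈ C) (hR : R ∈ C) (hL : L ∈ C)
    {γ : ℝ → E} (hγ : ContinuousOn γ (Icc 0 1)) (hav : ∀ s ∈ Icc (0 : ℝ) 1, γ s ∉ interior C) :
    ∃ δ, IsPush K γ δ ∧ ∀ s ∈ Icc (0 : ℝ) 1, δ s ∈ interior K → edgeForm X Y T R (δ s) < 0 := by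
  classical
  obtain ⟨f, hfK, hfix, hf⟩ := hc.exists_push_map hK hKc hXd hYd
  set P : Set E := {p ∈ K | 0 ≤ edgeForm X Y T R p} with hP
  have hPc : IsClosed P :=
    hK.isClosed.inter (isClosed_le continuous_const (continuous_edgeForm X Y T R))
  set δ : ℝ → E := fun s => if γ s ∈ P then f (γ s) else γ s with hδ
  have hδP : ∀ {s}, γ s ∈ P → δ s = f (γ s) := fun h => if_pos h
  have hδn : ∀ {s}, γ s ∉ P → δ s = γ s := fun h => if_neg h
  have heq : ∀ s, γ s ∉ interior K → δ s = γ s := by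
    intro s hs
    by_cases h : γ s ∈ P
    · rw [hδP h, hfix _ ⟨h.1, hs⟩ h.2]
    · exact hδn h
  have hpocket : ∀ s ∈ Icc (0 : ℝ) 1, γ s ∈ P → γ s ∈ interior K →
      ∀ᶠ x in 𝓝[Icc 0 1] s, γ x ∈ P := by
    intro s hs hsP hsK
    have hKev := (hγ s hs).eventually (isOpen_interior.mem_nhds hsK)
    rcases hsP.2.eq_or_lt with h0 | h0
    · have hnhds := mem_interior_iff_mem_nhds.1 hsK
      have hlt : ∀ Z : E →L[ℝ] ℝ, Z d = 1 → ∃ q ∈ K, Z (γ s) < Z q := by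
        intro Z hZ
        have hcont : Continuous fun c : ℝ => γ s + c • d := by fun_prop
        have hev : ∀ᶠ c : ℝ in 𝓝 0, γ s + c • d ∈ K :=
          hcont.continuousAt.eventually (by simpa using hnhds)
        obtain ⟨c, hcK, hc0⟩ :=
          ((hev.filter_mono nhdsWithin_le_nhds).and (self_mem_nhdsWithin (s := Ioi 0))).exists
        refine ⟨_, hcK, ?_⟩
        have : 0 < c := hc0
        simp [hZ, this]
      obtain ⟨q, hq, hXq⟩ := hlt X hXd
      obtain ⟨q', hq', hYq⟩ := hlt Y hYd
      have hint := (hγ s hs).eventually (hc.eventually_mem_interior hC hT hR hL h0.symm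
        (hXq.trans_le (hc.le_X q hq)) (hYq.trans_le (hc.le_Y q' hq')))
      filter_upwards [hKev, hint, self_mem_nhdsWithin] with x hx1 hx2 hx3
      refine ⟨interior_subset hx1, ?_⟩
      by_contra! hneg
      exact hav x hx3 (hx2 hneg)
    · have hpos := (hγ s hs).eventually
        ((continuous_edgeForm X Y T R).continuousAt.eventually_const_lt h0)
      filter_upwards [hKev, hpos] with x hx1 hx2
      exact ⟨interior_subset hx1, hx2.le⟩
  have hloc : ∀ s ∈ Icc (0 : ℝ) 1, ∀ᶠ x in 𝓝[Icc 0 1] s,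
      edist (δ s) (δ x) ≤ edist (γ s) (γ x) := by
    intro s hs
    by_cases hsP : γ s ∈ P
    · by_cases hsK : γ s ∈ interior K
      · filter_upwards [hpocket s hs hsP hsK] with x hx
        rw [hδP hsP, hδP hx]
        exact hf _ hsP.1 _ hx.1 hsP.2 hx.2
      · refine Eventually.of_forall fun x => ?_
        by_cases hx : γ x ∈ P
        · rw [hδP hsP, hδP hx]
          exact hf _ hsP.1 _ hx.1 hsP.2 hx.2
        · rw [heq s hsK, hδn hx]
    · filter_upwards [(hγ s hs).eventually (hPc.isOpen_compl.mem_nhds hsP)] with x hx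
      rw [hδn hsP, hδn hx]
  refine ⟨δ, ⟨continuousOn_of_eventually_edist_le hγ hloc,
    eVariationOn_Icc_le_of_eventually_edist_le hloc, fun s _ => ?_, fun s _ => heq s⟩,
    fun s _ hsK => ?_⟩
  · by_cases h : γ s ∈ P
    · right
      rw [hδP h]
      exact hfK _ h.1
    · exact Or.inl (hδn h)
  · by_cases h : γ s ∈ P
    · rw [hδP h] at hsK
      exact absurd hsK (hfK _ h.1).2
    · rw [hδn h] at hsK ⊢
      by_contra! hge
      exact h ⟨interior_subset hsK, hge⟩

end Corner

section Obstacle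

/-- The linear functional `a x` on the plane. -/
def xForm (a : ℝ) : Plane →L[ℝ] ℝ := a • WithLp.fstL 1 ℝ ℝ ℝ

/-- The linear functional `b y` on the plane. -/
def yForm (b : ℝ) : Plane →L[ℝ] ℝ := b • WithLp.sndL 1 ℝ ℝ ℝ

theorem xForm_apply (a : ℝ) (p : Plane) : xForm a p = a * px p := rfl

theorem yForm_apply (b : ℝ) (p : Plane) : yForm b p = b * py p := rfl

theorem Plane.dist_eq (p q : Plane) : dist p q = |px p - px q| + |py p - py q| := by
  rw [WithLp.prod_dist_eq_of_L1]
  rfl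

theorem isL1Corner_plane {K : Set Plane} {T R L : Plane} {a b : ℝ} (ha : |a| = 1) (hb : |b| = 1)
    (hT : T ∈ K) (hR : R ∈ K) (hL : L ∈ K) (hX : ∀ q ∈ K, a * px q ≤ a * px R)
    (hY : ∀ q ∈ K, b * py q ≤ b * py T) (hLX : a * px L ≤ a * px T) (hTR : T ≠ R) (hLT : L ≠ T) :
    IsL1Corner (xForm a) (yForm b) K T R L where
  dist_eq p q := by
    simp only [xForm_apply, yForm_apply, ← mul_sub, abs_mul, ha, hb, one_mul, Plane.dist_eq]
  T_mem := hT
  R_mem := hR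
  L_mem := hL
  le_X := hX
  le_Y := hY
  L_le := hLX
  T_ne_R := hTR
  L_ne_T := hLT

theorem exists_isPush_plane {K C : Set Plane} {T R L : Plane} {a b : ℝ} (ha : |a| = 1)
    (hb : |b| = 1) (hc : IsL1Corner (xForm a) (yForm b) K T R L) (hK : IsCompact K)
    (hKc : Convex ℝ K) (hC : Convex ℝ C) (hT : T ∈ C) (hR : R ∈ C) (hL : L ∈ C) {γ : ℝ → Plane}
    (hγ : ContinuousOn γ (Icc 0 1)) (hav : ∀ s ∈ Icc (0 : ℝ) 1, γ s ∉ interior C) :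
    ∃ δ, IsPush K γ δ ∧ ∀ s ∈ Icc (0 : ℝ) 1,
      δ s ∉ interior K ∩ {p | 0 ≤ edgeForm (xForm a) (yForm b) T R p} := by
  have sq : ∀ {c : ℝ}, |c| = 1 → c * c = 1 := fun h => by rw [← abs_mul_abs_self, h, one_mul]
  obtain ⟨δ, h1, h2⟩ := hc.exists_isPush hK hKc (d := WithLp.toLp 1 (a, b))
    (by rw [xForm_apply]; exact sq ha) (by rw [yForm_apply]; exact sq hb) hC hT hR hL hγ hav
  exact ⟨δ, h1, fun s hs h => absurd (h2 s hs h.1) (not_lt.2 h.2)⟩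

/-- A point dominated in each of the four diagonal directions by a point of a closed convex set
belongs to that set. -/
theorem mem_of_forall_quadrant {C : Set Plane} (hC : Convex ℝ C) (hCc : IsClosed C) {p : Plane}
    (h : ∀ a b : ℝ, |a| = 1 → |b| = 1 →
      ∃ w ∈ C, a * px p ≤ a * px w ∧ b * py p ≤ b * py w) : p ∈ C := by
  by_contra hp
  obtain ⟨f, u, hfC, hfp⟩ := geometric_hahn_banach_closed_point hC hCc hp
  set A := f (WithLp.toLp 1 (1, 0)) with hA
  set B := f (WithLp.toLp 1 (0, 1)) with hB
  have hf : ∀ q, f q = A * px q + B * py q := by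
    intro q
    have : q = px q • WithLp.toLp 1 ((1 : ℝ), (0 : ℝ)) +
        py q • WithLp.toLp 1 ((0 : ℝ), (1 : ℝ)) := by
      apply (WithLp.equiv 1 (ℝ × ℝ)).injective
      ext <;> simp [px, py]
    conv_lhs => rw [this]
    simp only [map_add, map_smul, smul_eq_mul, hA, hB]
    ring
  have hsign : ∀ c : ℝ, ∃ a : ℝ, |a| = 1 ∧ c = |c| * a := by
    intro c
    rcases le_total 0 c with h | h
    · exact ⟨1, by simp, by rw [abs_of_nonneg h, mul_one]⟩
    · exact ⟨-1, by simp, by rw [abs_of_nonpos h]; ring⟩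
  obtain ⟨a, ha, haA⟩ := hsign A
  obtain ⟨b, hb, hbB⟩ := hsign B
  obtain ⟨w, hw, hx, hy⟩ := h a b ha hb
  have h1 := hfC w hw
  rw [hf] at h1 hfp
  have hx' := mul_le_mul_of_nonneg_left hx (abs_nonneg A)
  have hy' := mul_le_mul_of_nonneg_left hy (abs_nonneg B)
  rw [← mul_assoc, ← mul_assoc, ← haA] at hx'
  rw [← mul_assoc, ← mul_assoc, ← hbB] at hy'
  linarith

/-- A path avoiding the core of an obstacle can be pushed out of the obstacle. -/
theorem exists_isPush_obstacle {K : Set Plane} (hK : IsCompact K) (hKc : Convex ℝ K)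
    {l r t m : Plane} (hl : l ∈ K) (hr : r ∈ K) (ht : t ∈ K) (hm : m ∈ K)
    (hlmin : ∀ q ∈ K, px l ≤ px q) (hrmax : ∀ q ∈ K, px q ≤ px r)
    (htmax : ∀ q ∈ K, py q ≤ py t) (hmmin : ∀ q ∈ K, py m ≤ py q)
    (hne : l ≠ r ∧ l ≠ t ∧ l ≠ m ∧ r ≠ t ∧ r ≠ m ∧ t ≠ m) {γ : ℝ → Plane}
    (hγ : ContinuousOn γ (Icc 0 1))
    (hav : ∀ s ∈ Icc (0 : ℝ) 1, γ s ∉ interior (convexHull ℝ {l, r, t, m})) :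
    ∃ δ, IsPush K γ δ ∧ ∀ s ∈ Icc (0 : ℝ) 1, δ s ∉ interior K := by
  set C := convexHull ℝ {l, r, t, m} with hCdef
  have hC : Convex ℝ C := convex_convexHull ℝ _
  have hCc : IsClosed C := (Set.toFinite {l, r, t, m}).isClosed_convexHull ℝ
  have hCK : C ⊆ K := convexHull_min (by
    rintro x (rfl | rfl | rfl | rfl) <;> assumption) hKc
  have hlC : l ∈ C := subset_convexHull ℝ _ (by simp)
  have hrC : r ∈ C := subset_convexHull ℝ _ (by simp)
  have htC : t ∈ C := subset_convexHull ℝ _ (by simp)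
  have hmC : m ∈ C := subset_convexHull ℝ _ (by simp)
  obtain ⟨hlr, hlt, hlm, hrt, hrm, htm⟩ := hne
  have e1 : |(1 : ℝ)| = 1 := by simp
  have e2 : |(-1 : ℝ)| = 1 := by simp
  have c1 : IsL1Corner (xForm 1) (yForm 1) K t r l :=
    isL1Corner_plane e1 e1 ht hr hl (by simpa using hrmax) (by simpa using htmax)
      (by simpa using hlmin t ht) hrt.symm hlt
  have c2 : IsL1Corner (xForm (-1)) (yForm 1) K t l r :=
    isL1Corner_plane e2 e1 ht hl hr (by simpa using hlmin) (by simpa using htmax)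
      (by simpa using hrmax t ht) hlt.symm hrt
  have c3 : IsL1Corner (xForm 1) (yForm (-1)) K m r l :=
    isL1Corner_plane e1 e2 hm hr hl (by simpa using hrmax) (by simpa using hmmin)
      (by simpa using hlmin m hm) hrm.symm hlm
  have c4 : IsL1Corner (xForm (-1)) (yForm (-1)) K m l r :=
    isL1Corner_plane e2 e2 hm hl hr (by simpa using hlmin) (by simpa using hmmin)
      (by simpa using hrmax m hm) hlm.symm hrm
  have dC : Disjoint (interior C) (K \ interior K) :=
    disjoint_sdiff_right.mono_left (interior_mono hCK)
  have dK : ∀ S : Set Plane, Disjoint (interior K ∩ S) (K \ interior K) := fun S =>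
    disjoint_sdiff_right.mono_left inter_subset_left
  obtain ⟨γ₁, p₁, n₁⟩ := exists_isPush_plane e1 e1 c1 hK hKc hC htC hrC hlC hγ hav
  have a₁ := p₁.notMem dC hav
  obtain ⟨γ₂, p₂, n₂⟩ :=
    exists_isPush_plane e2 e1 c2 hK hKc hC htC hlC hrC p₁.continuousOn a₁
  have a₂ := p₂.notMem dC a₁
  obtain ⟨γ₃, p₃, n₃⟩ :=
    exists_isPush_plane e1 e2 c3 hK hKc hC hmC hrC hlC p₂.continuousOn a₂
  have a₃ := p₃.notMem dC a₂
  obtain ⟨γ₄, p₄, n₄⟩ :=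
    exists_isPush_plane e2 e2 c4 hK hKc hC hmC hlC hrC p₃.continuousOn a₃
  have a₄ := p₄.notMem dC a₃
  have b₁ := p₄.notMem (dK _) (p₃.notMem (dK _) (p₂.notMem (dK _) n₁))
  have b₂ := p₄.notMem (dK _) (p₃.notMem (dK _) n₂)
  have b₃ := p₄.notMem (dK _) n₃
  refine ⟨γ₄, p₁.trans (p₂.trans (p₃.trans p₄)), fun s hs hsK => ?_⟩
  set U : Set Plane := interior K ∩
    ({p | edgeForm (xForm 1) (yForm 1) t r p < 0} ∩
     {p | edgeForm (xForm (-1)) (yForm 1) t l p < 0} ∩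
     ({p | edgeForm (xForm 1) (yForm (-1)) m r p < 0} ∩
      {p | edgeForm (xForm (-1)) (yForm (-1)) m l p < 0})) with hU
  have hopen : ∀ (X Y : Plane →L[ℝ] ℝ) (T R : Plane), IsOpen {p | edgeForm X Y T R p < 0} :=
    fun X Y T R => isOpen_lt (continuous_edgeForm X Y T R) continuous_const
  have hUo : IsOpen U := isOpen_interior.inter
    (((hopen _ _ _ _).inter (hopen _ _ _ _)).inter ((hopen _ _ _ _).inter (hopen _ _ _ _)))
  have hUC : U ⊆ C := by
    rintro p ⟨hpK, ⟨h1, h2⟩, h3, h4⟩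
    have hpK := interior_subset hpK
    refine mem_of_forall_quadrant hC hCc fun a b ha hb => ?_
    have aux : ∀ {a b : ℝ} {T R L : Plane}, IsL1Corner (xForm a) (yForm b) K T R L → T ∈ C →
        R ∈ C → edgeForm (xForm a) (yForm b) T R p < 0 →
        ∃ w ∈ C, a * px p ≤ a * px w ∧ b * py p ≤ b * py w := by
      intro a b T R L hc hT hR hn
      obtain ⟨w, hw, hw'⟩ := hc.exists_mem_segment_ge hpK hn
      exact ⟨w, hC.segment_subset hT hR hw, hw'⟩
    rcases eq_or_eq_neg_of_abs_eq ha with rfl | rfl <;>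
      rcases eq_or_eq_neg_of_abs_eq hb with rfl | rfl
    · exact aux c1 htC hrC h1
    · exact aux c3 hmC hrC h3
    · exact aux c2 htC hlC h2
    · exact aux c4 hmC hlC h4
  have hout : ∀ {X Y : Plane →L[ℝ] ℝ} {T R : Plane},
      γ₄ s ∉ interior K ∩ {p | 0 ≤ edgeForm X Y T R p} → edgeForm X Y T R (γ₄ s) < 0 :=
    fun h => not_le.1 fun h' => h ⟨hsK, h'⟩
  exact a₄ s hs (interior_maximal hUC hUo ⟨hsK, ⟨hout (b₁ s hs), hout (b₂ s hs)⟩,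
    hout (b₃ s hs), hout (n₄ s hs)⟩)

theorem Convex.disjoint_interior_diff_interior {K K' : Set Plane} (hK : Convex ℝ K)
    (hne : (interior K).Nonempty) (hd : Disjoint (interior K') (interior K)) :
    Disjoint (interior K') (K \ interior K) := by
  have h := hd.closure_right isOpen_interior
  rw [hK.closure_interior_eq_closure_of_nonempty_interior hne] at h
  exact h.mono_right (sdiff_subset.trans subset_closure)

end Obstacle

/-- The `L1` geodesic distance among the obstacles equals the `L1` geodesic
distance among their cores: the infimum of `L1` lengths of continuous `s`–`t`
paths avoiding the interiors of all cores equals the infimum over paths avoiding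
the interiors of all obstacles. -/
theorem geodesic_dist_cores_eq_obstacles (h : ℕ) (K : Fin h → Set Plane)
    (hKc : ∀ i, IsCompact (K i)) (hKconv : ∀ i, Convex ℝ (K i))
    (hKdisj : Pairwise fun i j => Disjoint (interior (K i)) (interior (K j)))
    (l r t m : Fin h → Plane)
    (hl : ∀ i, l i ∈ K i) (hr : ∀ i, r i ∈ K i)
    (ht : ∀ i, t i ∈ K i) (hm : ∀ i, m i ∈ K i)
    (hlmin : ∀ i, ∀ q ∈ K i, px (l i) ≤ px q)
    (hrmax : ∀ i, ∀ q ∈ K i, px q ≤ px (r i))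
    (htmax : ∀ i, ∀ q ∈ K i, py q ≤ py (t i))
    (hmmin : ∀ i, ∀ q ∈ K i, py (m i) ≤ py q)
    (hne : ∀ i, l i ≠ r i ∧ l i ≠ t i ∧ l i ≠ m i ∧
                r i ≠ t i ∧ r i ≠ m i ∧ t i ≠ m i)
    (s tgt : Plane) (hs : ∀ i, s ∉ interior (K i)) (htgt : ∀ i, tgt ∉ interior (K i)) :
    sInf {L : ℝ≥0∞ | ∃ γ : ℝ → Plane, ContinuousOn γ (Set.Icc 0 1) ∧
        γ 0 = s ∧ γ 1 = tgt ∧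
        Disjoint (γ '' Set.Icc 0 1)
          (⋃ i, interior (convexHull ℝ {l i, r i, t i, m i})) ∧
        L = eVariationOn γ (Set.Icc 0 1)} =
    sInf {L : ℝ≥0∞ | ∃ γ : ℝ → Plane, ContinuousOn γ (Set.Icc 0 1) ∧
        γ 0 = s ∧ γ 1 = tgt ∧
        Disjoint (γ '' Set.Icc 0 1) (⋃ i, interior (K i)) ∧
        L = eVariationOn γ (Set.Icc 0 1)} := by
  refine le_antisymm (sInf_le_sInf ?_) (le_sInf ?_)
  · rintro L ⟨γ, hγ, h0, h1, hav, rfl⟩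
    refine ⟨γ, hγ, h0, h1, hav.mono_right (iUnion_mono fun i => interior_mono ?_), rfl⟩
    refine convexHull_min ?_ (hKconv i)
    rintro x (rfl | rfl | rfl | rfl)
    exacts [hl i, hr i, ht i, hm i]
  · rintro L ⟨γ, hγ, h0, h1, hav, rfl⟩
    have hcore : ∀ i, ∀ x ∈ Icc (0 : ℝ) 1,
        γ x ∉ interior (convexHull ℝ {l i, r i, t i, m i}) := fun i x hx hmem =>
      disjoint_left.1 hav (mem_image_of_mem γ hx) (mem_iUnion.2 ⟨i, hmem⟩)
    have hsub : ∀ i, convexHull ℝ {l i, r i, t i, m i} ⊆ K i := fun i =>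
      convexHull_min (by
        rintro x (rfl | rfl | rfl | rfl)
        exacts [hl i, hr i, ht i, hm i]) (hKconv i)
    have key : ∀ S : Finset (Fin h), ∃ δ : ℝ → Plane, ContinuousOn δ (Icc 0 1) ∧ δ 0 = s ∧
        δ 1 = tgt ∧ eVariationOn δ (Icc 0 1) ≤ eVariationOn γ (Icc 0 1) ∧
        (∀ i, ∀ x ∈ Icc (0 : ℝ) 1, δ x ∉ interior (convexHull ℝ {l i, r i, t i, m i})) ∧
        ∀ i ∈ S, ∀ x ∈ Icc (0 : ℝ) 1, δ x ∉ interior (K i) := by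
      intro S
      induction S using Finset.induction_on with
      | empty => exact ⟨γ, hγ, h0, h1, le_rfl, hcore, by simp⟩
      | insert i S _ ih =>
        obtain ⟨δ, hδ, hδ0, hδ1, hlen, hδc, hδS⟩ := ih
        rcases (interior (K i)).eq_empty_or_nonempty with hemp | hint
        · refine ⟨δ, hδ, hδ0, hδ1, hlen, hδc, fun j hj => ?_⟩
          rcases Finset.mem_insert.1 hj with rfl | hj
          · simp [hemp]
          · exact hδS j hj
        · obtain ⟨η, hη, hηi⟩ := exists_isPush_obstacle (hKc i) (hKconv i) (hl i) (hr i) (ht i)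
            (hm i) (hlmin i) (hrmax i) (htmax i) (hmmin i) (hne i) hδ (hδc i)
          have hdisj : ∀ j, Disjoint (interior (K j)) (K i \ interior (K i)) := by
            intro j
            rcases eq_or_ne j i with rfl | hji
            · exact disjoint_sdiff_right
            · exact (hKconv i).disjoint_interior_diff_interior hint (hKdisj hji)
          refine ⟨η, hη.continuousOn, ?_, ?_, hη.eVariationOn_le.trans hlen, fun j =>
            hη.notMem ((hdisj j).mono_left (interior_mono (hsub j))) (hδc j), fun j hj => ?_⟩
          · rw [hη.eq_of_notMem 0 (by simp) (by rw [hδ0]; exact hs i), hδ0]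
          · rw [hη.eq_of_notMem 1 (by simp) (by rw [hδ1]; exact htgt i), hδ1]
          · rcases Finset.mem_insert.1 hj with rfl | hj
            · exact hηi
            · exact hη.notMem (hdisj j) (hδS j hj)
    obtain ⟨δ, hδ, hδ0, hδ1, hlen, -, hδK⟩ := key Finset.univ
    have hdisj : Disjoint (δ '' Icc 0 1) (⋃ i, interior (K i)) := by
      rw [disjoint_left]
      rintro _ ⟨x, hx, rfl⟩ hmem
      obtain ⟨i, hi⟩ := mem_iUnion.1 hmem
      exact hδK i (Finset.mem_univ i) x hx hi
    refine le_trans (sInf_le ?_) hlen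
    exact ⟨δ, hδ, hδ0, hδ1, hdisj, rfl⟩
end
end
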